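/- For z, ω₁, ..., ω_r in the upper half-plane, exp(−∂ξ_{r+1}/∂s (0, z | e^{πi}; ω₁,...,ω_r)) equals the r-fold q-shifted factorial ∏_{m₁,...,m_r ≥ 0} (1 − e^{2πi(z + m₁ω₁ + ... + m_rω_r)}). -/

import Mathlib

open Complex Real

/-- The Barnes multiple zeta series (principal-branch powers). -/
noncomputable def barnesZeta (r : ℕ) (s z : ℂ) (ω : Fin r → ℂ) : ℂ :=
  ∑' m : Fin r → ℕ, (z + ∑ j, (m j : ℂ) * ω j) ^ (-s)

/-- The bilateral multiple zeta series `ξ_{r+1}(s, z | e^{πi}; ω)`, where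
`e^{πi} = -1` (with principal argument `π`) and `-e^{πi} = 1`:
`ξ_{r+1}(s,z|e^{πi};ω) = ζ_{r+1}(s, z + e^{πi} | e^{πi}, ω) + ζ_{r+1}(s, z | 1, ω)`. -/
noncomputable def xiSeries (r : ℕ) (s z : ℂ) (ω : Fin r → ℂ) : ℂ :=
  barnesZeta (r + 1) s (z + (-1)) (Fin.cons (-1) ω)
    + barnesZeta (r + 1) s z (Fin.cons 1 ω)

open Filter Set MeasureTheory Topology in
/-- The Gamma integral `∫ t^(a-1) e^(-rt)` for complex `r` in the right half-plane. -/
theorem integral_cpow_mul_cexp_neg_mul_Ioi {a r : ℂ} (ha : 0 < a.re) (hr : 0 < r.re) :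
    ∫ t : ℝ in Ioi 0, (t : ℂ) ^ (a - 1) * cexp (-(r * t)) = (1 / r) ^ a * Complex.Gamma a := by
  have hU : IsOpen {w : ℂ | 0 < w.re} := isOpen_lt continuous_const Complex.continuous_re
  have hmeas (b : ℂ) (w : ℂ) : AEStronglyMeasurable
      (fun t : ℝ ↦ (t : ℂ) ^ b * cexp (-(w * t))) (volume.restrict (Ioi 0)) := by
    refine ContinuousOn.aestronglyMeasurable (fun t ht ↦ ?_) measurableSet_Ioi
    exact ((Complex.continuousAt_ofReal_cpow_const t b (Or.inr (ne_of_gt ht))).mul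
      (by fun_prop)).continuousWithinAt
  have hnorm (b : ℂ) (w : ℂ) (t : ℝ) (ht : 0 < t) :
      ‖(t : ℂ) ^ b * cexp (-(w * t))‖ = t ^ b.re * rexp (-w.re * t ^ (1 : ℝ)) := by
    rw [norm_mul, Complex.norm_cpow_eq_rpow_re_of_pos ht, Complex.norm_exp]
    simp
  have hintegr (b : ℂ) (hb : -1 < b.re) (w : ℂ) (hw : 0 < w.re) :
      IntegrableOn (fun t : ℝ ↦ (t : ℂ) ^ b * cexp (-(w * t))) (Ioi 0) := by
    refine Integrable.mono' (integrableOn_rpow_mul_exp_neg_mul_rpow hb one_pos hw)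
      (hmeas b w) ?_
    filter_upwards [ae_restrict_mem measurableSet_Ioi] with t ht
    exact (hnorm b w t ht).le
  have hdiff : DifferentiableOn ℂ
      (fun w : ℂ ↦ ∫ t : ℝ in Ioi 0, (t : ℂ) ^ (a - 1) * cexp (-(w * t))) {w : ℂ | 0 < w.re} := by
    intro w hw
    have hw' : 0 < w.re := hw
    have := (hasDerivAt_integral_of_dominated_loc_of_deriv_le
      (F := fun (w : ℂ) (t : ℝ) ↦ (t : ℂ) ^ (a - 1) * cexp (-(w * t)))
      (F' := fun (w : ℂ) (t : ℝ) ↦ -((t : ℂ) ^ a * cexp (-(w * t))))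
      (μ := volume.restrict (Ioi 0)) (x₀ := w) (s := {v : ℂ | w.re / 2 < v.re})
      (bound := fun t ↦ t ^ a.re * rexp (-(w.re / 2) * t ^ (1 : ℝ)))
      ((isOpen_lt continuous_const Complex.continuous_re).mem_nhds (by simp; linarith))
      (Eventually.of_forall fun v ↦ hmeas _ v) (hintegr _ (by simpa using ha) w hw')
      (hmeas a w).neg ?_
      (integrableOn_rpow_mul_exp_neg_mul_rpow (by linarith) one_pos (by linarith)) ?_).2
    · exact this.differentiableAt.differentiableWithinAt
    · filter_upwards [ae_restrict_mem measurableSet_Ioi] with t ht v hv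
      have ht' : 0 < t := ht
      have hv' : w.re / 2 < v.re := hv
      rw [norm_neg, hnorm a v t ht]
      gcongr
    · filter_upwards [ae_restrict_mem measurableSet_Ioi] with t ht v hv
      have ht' : (t : ℂ) ≠ 0 := by exact_mod_cast (ne_of_gt ht)
      have h1 : HasDerivAt (fun v : ℂ ↦ -(v * t)) (-(t : ℂ)) v := by
        exact (hasDerivAt_mul_const (t : ℂ)).fun_neg
      refine (h1.cexp.const_mul ((t : ℂ) ^ (a - 1))).congr_deriv ?_
      have : (t : ℂ) ^ a = (t : ℂ) ^ (a - 1) * t := by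
        rw [Complex.cpow_sub _ _ ht', Complex.cpow_one]; field_simp
      rw [this]; ring
  have hdiff' : DifferentiableOn ℂ (fun w : ℂ ↦ (1 / w) ^ a * Complex.Gamma a)
      {w : ℂ | 0 < w.re} := by
    intro w hw
    have hw' : 0 < w.re := hw
    have hw0 : w ≠ 0 := by rintro rfl; simp at hw'
    refine DifferentiableAt.differentiableWithinAt ?_
    refine DifferentiableAt.mul_const
      (DifferentiableAt.cpow_const (by fun_prop (disch := assumption)) ?_) _
    left
    rw [one_div, Complex.inv_re]
    exact div_pos hw' (Complex.normSq_pos.mpr hw0)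
  have hfreq : ∃ᶠ w in 𝓝[≠] (1 : ℂ),
      ∫ t : ℝ in Ioi 0, (t : ℂ) ^ (a - 1) * cexp (-(w * t)) = (1 / w) ^ a * Complex.Gamma a := by
    have htend : Tendsto (fun x : ℝ ↦ (x : ℂ)) (𝓝[≠] (1 : ℝ)) (𝓝[≠] (1 : ℂ)) := by
      refine tendsto_nhdsWithin_iff.mpr ⟨?_, ?_⟩
      · exact (Complex.continuous_ofReal.tendsto' 1 1 (by simp)).mono_left nhdsWithin_le_nhds
      · filter_upwards [self_mem_nhdsWithin] with x hx
        simpa using hx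
    refine htend.frequently (Eventually.frequently ?_)
    filter_upwards [nhdsWithin_le_nhds (lt_mem_nhds one_pos)] with x hx
    exact Complex.integral_cpow_mul_exp_neg_mul_Ioi ha hx
  exact (hdiff.analyticOnNhd hU).eqOn_of_preconnected_of_frequently_eq
    (hdiff'.analyticOnNhd hU) (convex_halfSpace_re_gt 0).isPreconnected
    (by simp : (1 : ℂ) ∈ {w : ℂ | 0 < w.re}) hfreq hr

theorem one_div_neg_two_pi_I_mul_cpow {u : ℂ} (hu : 0 < u.im) (s : ℂ) :
    (1 / (-(2 * π * I * u))) ^ s = (2 * π : ℂ) ^ (-s) * cexp (π * I * s / 2) * u ^ (-s) := by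
  have hu0 : u ≠ 0 := by rintro rfl; simp at hu
  have hπ : (2 * π : ℂ) ≠ 0 := by simp [Real.pi_ne_zero]
  have hlog : (Complex.log (2 * π : ℂ)).im = 0 := by
    rw [Complex.log_im]
    have : (2 * π : ℂ) = ((2 * π : ℝ) : ℂ) := by push_cast; rfl
    rw [this, Complex.arg_ofReal_of_nonneg (by positivity)]
  have hL : 1 / (-(2 * π * I * u)) = cexp (-Complex.log (2 * π) + π / 2 * I - Complex.log u) := by
    rw [Complex.exp_sub, Complex.exp_add, Complex.exp_neg, Complex.exp_log hπ, Complex.exp_log hu0,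
      Complex.exp_pi_div_two_mul_I]
    field_simp
    simp
  have h1 : 0 < u.arg := by
    rcases (Complex.arg_nonneg_iff.mpr hu.le).lt_or_eq with h | h
    · exact h
    · rw [eq_comm, Complex.arg_eq_zero_iff] at h
      exact absurd h.2 hu.ne'
  have h2 := Complex.arg_le_pi u
  have him : (-Complex.log (2 * π) + π / 2 * I - Complex.log u).im = π / 2 - u.arg := by
    have : (π / 2 * I : ℂ).im = π / 2 := by
      have : (π / 2 * I : ℂ) = ((π / 2 : ℝ) : ℂ) * I := by push_cast; rfl
      rw [this, Complex.im_ofReal_mul, Complex.I_im, mul_one]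
    rw [Complex.sub_im, Complex.add_im, Complex.neg_im, hlog, this, Complex.log_im]; ring
  have hpi := Real.pi_pos
  rw [Complex.cpow_def_of_ne_zero (by rw [hL]; exact Complex.exp_ne_zero _),
    Complex.cpow_def_of_ne_zero hπ, Complex.cpow_def_of_ne_zero hu0, hL,
    Complex.log_exp (by rw [him]; linarith) (by rw [him]; linarith), ← Complex.exp_add,
    ← Complex.exp_add]
  congr 1
  ring

theorem norm_cpow_le_exp_pi_mul (w s : ℂ) :
    ‖w ^ (-s)‖ ≤ rexp (π * |s.im|) * ‖w‖ ^ (-s.re) := by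
  refine (Complex.norm_cpow_le w (-s)).trans ?_
  rw [div_eq_mul_inv, ← Real.exp_neg, mul_comm, Complex.neg_re, Complex.neg_im]
  gcongr
  rw [mul_neg, neg_neg]
  calc _ ≤ |w.arg * s.im| := le_abs_self _
    _ = |w.arg| * |s.im| := abs_mul _ _
    _ ≤ _ := by gcongr; exact Complex.abs_arg_le_pi w

theorem summable_fin_prod {r : ℕ} {f : Fin r → ℕ → ℝ} (hf : ∀ j n, 0 ≤ f j n)
    (hs : ∀ j, Summable (f j)) : Summable fun m : Fin r → ℕ ↦ ∏ j, f j (m j) := by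
  induction r with
  | zero => exact (hasSum_fintype _).summable
  | succ r ih =>
    rw [← (Fin.consEquiv fun _ ↦ ℕ).summable_iff]
    refine ((hs 0).mul_of_nonneg (ih (fun j n ↦ hf j.succ n) fun j ↦ hs j.succ)
      (fun n ↦ hf 0 n) (fun m ↦ Finset.prod_nonneg fun j _ ↦ hf _ _)).congr fun p ↦ ?_
    simp [Fin.consEquiv, Fin.prod_univ_succ]

theorem summable_cpow_shifted_cone {r : ℕ} {z : ℂ} {ω : Fin r → ℂ} (hz : 0 < z.im)
    (hω : ∀ j, 0 < (ω j).im) {u : ℕ → ℝ} (hu : ∀ n : ℕ, (n : ℝ) ≤ |u n|) {s : ℂ}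
    (hs : (r : ℝ) + 1 < s.re) :
    Summable fun p : ℕ × (Fin r → ℕ) ↦ (z + u p.1 + ∑ j, (p.2 j : ℂ) * ω j) ^ (-s) := by
  obtain ⟨δ, hδ, hδz, hδω⟩ : ∃ δ : ℝ, 0 < δ ∧ δ ≤ z.im ∧ ∀ j, δ ≤ (ω j).im := by
    obtain ⟨δ, hδ, h⟩ : ∃ δ : ℝ, 0 < δ ∧ ∀ j, δ ≤ (ω j).im := by
      rcases isEmpty_or_nonempty (Fin r) with h | h
      · exact ⟨1, one_pos, fun j ↦ h.elim j⟩
      · obtain ⟨i, hi⟩ := Finite.exists_min fun j ↦ (ω j).im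
        exact ⟨_, hω i, hi⟩
    exact ⟨min δ z.im, lt_min hδ hz, min_le_right _ _, fun j ↦ (min_le_left _ _).trans (h j)⟩
  set C : ℝ := ‖z‖ + ∑ j, ‖ω j‖ with hC
  have hC0 : 0 ≤ C := by positivity
  have hCω (j) : ‖ω j‖ ≤ C := by
    have := Finset.single_le_sum (f := fun j ↦ ‖ω j‖) (fun j _ ↦ norm_nonneg _) (Finset.mem_univ j)
    have := norm_nonneg z
    linarith
  have hCz : ‖z‖ ≤ C := by
    have : 0 ≤ ∑ j, ‖ω j‖ := by positivity
    linarith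
  set K : ℝ := 1 + (C + 1) / δ with hK
  have hK0 : 0 < K := by positivity
  have hσ : 0 < s.re := by linarith [(Nat.cast_nonneg r : (0 : ℝ) ≤ r)]
  set q : ℝ := s.re / (r + 1) with hq
  have hr1 : (0 : ℝ) < r + 1 := by positivity
  have hq1 : 1 < q := by rw [hq, lt_div_iff₀ hr1]; linarith
  have hqs : ((r + 1 : ℕ) : ℝ) * (-q) = -s.re := by rw [hq]; push_cast; field_simp
  have hsum1 : Summable fun n : ℕ ↦ ((n : ℝ) + 1) ^ (-q) := by
    have := (summable_nat_add_iff 1).mpr (Real.summable_nat_rpow.mpr (by linarith : -q < -1))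
    simpa using this
  have key : Summable fun p : ℕ × (Fin r → ℕ) ↦ rexp (π * |s.im|) * K ^ s.re *
      (((p.1 : ℝ) + 1) ^ (-q) * ∏ j, ((p.2 j : ℝ) + 1) ^ (-q)) :=
    (hsum1.mul_of_nonneg (summable_fin_prod (fun _ _ ↦ by positivity) fun _ : Fin r ↦ hsum1)
      (fun _ ↦ by positivity) (fun _ ↦ by dsimp; positivity)).mul_left _
  refine Summable.of_norm_bounded key ?_
  rintro ⟨n, m⟩
  dsimp only
  set S : ℝ := ∑ j, (m j : ℝ) with hS
  have hS0 : 0 ≤ S := by positivity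
  set w : ℂ := z + u n + ∑ j, (m j : ℂ) * ω j with hw
  have him : δ * (1 + S) ≤ ‖w‖ := by
    refine le_trans ?_ (Complex.im_le_norm w)
    have : w.im = z.im + ∑ j, (m j : ℝ) * (ω j).im := by simp [hw]
    rw [this, mul_add, mul_one, hS, Finset.mul_sum]
    refine add_le_add hδz (Finset.sum_le_sum fun j _ ↦ ?_)
    rw [mul_comm]
    have := hδω j
    gcongr
  have hre : (n : ℝ) ≤ ‖w‖ + C * (1 + S) := by
    have h1 : (u n : ℂ) = w - (z + ∑ j, (m j : ℂ) * ω j) := by rw [hw]; ring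
    have h2 : ‖z + ∑ j, (m j : ℂ) * ω j‖ ≤ C * (1 + S) := by
      refine (norm_add_le _ _).trans ?_
      rw [mul_add, mul_one, hS, Finset.mul_sum]
      refine add_le_add hCz ((norm_sum_le _ _).trans (Finset.sum_le_sum fun j _ ↦ ?_))
      rw [norm_mul, Complex.norm_natCast, mul_comm]
      have := hCω j
      gcongr
    calc (n : ℝ) ≤ ‖(u n : ℂ)‖ := by simpa using hu n
      _ ≤ ‖w‖ + ‖z + ∑ j, (m j : ℂ) * ω j‖ := by rw [h1]; exact norm_sub_le _ _
      _ ≤ _ := by gcongr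
  have hlow : 1 + n + S ≤ K * ‖w‖ := by
    have : 1 + S ≤ ‖w‖ / δ := by rw [le_div_iff₀ hδ]; linarith
    have := mul_le_mul_of_nonneg_left this (by positivity : 0 ≤ C + 1)
    rw [hK, show (1 + (C + 1) / δ) * ‖w‖ = ‖w‖ + (C + 1) * (‖w‖ / δ) by ring]
    linarith
  have hw0 : 0 < ‖w‖ := lt_of_lt_of_le (by positivity) him
  have hprod : ((n : ℝ) + 1) * ∏ j, ((m j : ℝ) + 1) ≤ (1 + n + S) ^ (r + 1) := by
    rw [pow_succ', show (1 + n + S) ^ r = ∏ _j : Fin r, (1 + n + S) by simp]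
    refine mul_le_mul (by linarith) (Finset.prod_le_prod (fun _ _ ↦ by positivity) fun j _ ↦ ?_)
      (by positivity) (by positivity)
    have : (m j : ℝ) ≤ S := Finset.single_le_sum (f := fun j ↦ (m j : ℝ))
      (fun _ _ ↦ by positivity) (Finset.mem_univ j)
    have : (0 : ℝ) ≤ n := by positivity
    linarith
  refine (norm_cpow_le_exp_pi_mul w s).trans ?_
  rw [mul_assoc]
  gcongr
  rw [Real.finsetProd_rpow _ _ (fun _ _ ↦ by positivity),
    ← Real.mul_rpow (by positivity) (by positivity)]
  calc ‖w‖ ^ (-s.re) = K ^ s.re * (K * ‖w‖) ^ (-s.re) := by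
        rw [Real.mul_rpow hK0.le hw0.le, ← mul_assoc, ← Real.rpow_add hK0]; simp
    _ ≤ K ^ s.re * (1 + n + S) ^ (-s.re) := by
        refine mul_le_mul_of_nonneg_left ?_ (by positivity)
        exact Real.rpow_le_rpow_of_nonpos (by positivity) hlow (by linarith)
    _ = K ^ s.re * ((1 + n + S) ^ (r + 1)) ^ (-q) := by
        rw [← Real.rpow_natCast, ← Real.rpow_mul (by positivity), hqs]
    _ ≤ _ := by
        refine mul_le_mul_of_nonneg_left ?_ (by positivity)
        exact Real.rpow_le_rpow_of_nonpos (by positivity) hprod (by linarith)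

open Filter Asymptotics FourierTransform in
/-- **Lipschitz summation formula** for a complex exponent. -/
theorem tsum_int_add_cpow_neg {τ s : ℂ} (hτ : 0 < τ.im) (hs : 1 < s.re) :
    ∑' n : ℤ, (τ + n) ^ (-s) = (2 * π : ℂ) ^ s * cexp (-(π * I * s / 2)) / Complex.Gamma s *
      ∑' k : ℕ, ((k : ℂ) + 1) ^ (s - 1) * cexp (2 * π * I * τ * (k + 1)) := by
  have hs0 : 0 < s.re := by linarith
  have hs1 : s - 1 ≠ 0 := by
    intro h
    have := congrArg Complex.re h
    simp at this
    linarith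
  set g : ℝ → ℂ := fun t ↦ ((max t 0 : ℝ) : ℂ) ^ (s - 1) * cexp (2 * π * I * τ * t) with hg
  have hg_nonpos (t : ℝ) (ht : t ≤ 0) : g t = 0 := by
    simp [hg, max_eq_right ht, Complex.zero_cpow hs1]
  have hg_pos (t : ℝ) (ht : 0 < t) : g t = (t : ℂ) ^ (s - 1) * cexp (2 * π * I * τ * t) := by
    simp [hg, max_eq_left ht.le]
  have hcont : Continuous g := by
    refine Continuous.mul ?_ (by fun_prop)
    exact (Complex.continuous_ofReal_cpow_const (by simpa using hs)).comp
      (continuous_id.max continuous_const)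
  have hdecay : g =O[cocompact ℝ] (|·| ^ (-s.re)) := by
    rw [cocompact_eq_atBot_atTop, isBigO_sup]
    constructor
    · refine (isBigO_zero _ _).congr' ?_ EventuallyEq.rfl
      filter_upwards [eventually_le_atBot 0] with t ht using (hg_nonpos t ht).symm
    · have h1 : (fun t : ℝ ↦ rexp (-(2 * π * τ.im) * t)) =O[atTop]
          fun t ↦ t ^ (-s.re - (s.re - 1)) :=
        (isLittleO_exp_neg_mul_rpow_atTop (by positivity) _).isBigO
      have h2 := (isBigO_refl (fun t : ℝ ↦ t ^ (s.re - 1)) atTop).mul h1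
      refine (IsBigO.of_norm_left (h2.congr' ?_ ?_))
      · filter_upwards [eventually_gt_atTop 0] with t ht
        rw [hg_pos t ht, norm_mul, Complex.norm_cpow_eq_rpow_re_of_pos ht, Complex.norm_exp]
        simp
      · filter_upwards [eventually_gt_atTop 0] with t ht
        rw [← Real.rpow_add ht, abs_of_pos ht]
        congr 1
        ring
  have hfourier (w : ℝ) : 𝓕 g w =
      (2 * π : ℂ) ^ (-s) * cexp (π * I * s / 2) * Complex.Gamma s * (τ - w) ^ (-s) := by
    have him : 0 < (τ - w).im := by simpa using hτ
    rw [Real.fourier_real_eq_integral_exp_smul,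
      ← MeasureTheory.setIntegral_eq_integral_of_forall_compl_eq_zero (s := Set.Ioi 0)
        (fun t ht ↦ by rw [hg_nonpos t (by simpa using ht), smul_zero])]
    have := integral_cpow_mul_cexp_neg_mul_Ioi (a := s) (r := -(2 * π * I * (τ - w))) hs0
      (by simpa using mul_pos Real.two_pi_pos hτ)
    rw [one_div_neg_two_pi_I_mul_cpow him] at this
    rw [mul_right_comm, ← this]
    refine MeasureTheory.setIntegral_congr_fun measurableSet_Ioi fun t ht ↦ ?_
    rw [hg_pos t ht, smul_eq_mul, mul_left_comm, ← Complex.exp_add]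
    congr 2
    push_cast
    ring
  have hfdecay : 𝓕 g =O[cocompact ℝ] (|·| ^ (-s.re)) := by
    have h1 : (fun w : ℝ ↦ (τ - w) ^ (-s)) =O[cocompact ℝ] (|·| ^ (-s.re)) := by
      refine IsBigO.of_bound (rexp (π * |s.im|) * (1 / 2) ^ (-s.re)) ?_
      filter_upwards [(tendsto_norm_cocompact_atTop (E := ℝ)).eventually_ge_atTop (2 * ‖τ‖ + 1)]
        with w hw
      have hw1 : 0 < |w| := by
        have := norm_nonneg τ
        rw [Real.norm_eq_abs] at hw
        linarith
      have hw2 : 1 / 2 * |w| ≤ ‖τ - w‖ := by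
        have := norm_sub_norm_le (w : ℂ) τ
        rw [norm_sub_rev, Complex.norm_real, Real.norm_eq_abs] at this
        rw [Real.norm_eq_abs] at hw
        linarith
      refine (norm_cpow_le_exp_pi_mul _ s).trans ?_
      rw [mul_assoc, Real.norm_of_nonneg (by positivity), ← Real.mul_rpow (by positivity) hw1.le]
      refine mul_le_mul_of_nonneg_left ?_ (by positivity)
      exact Real.rpow_le_rpow_of_nonpos (by positivity) hw2 (by linarith)
    exact (h1.const_mul_left _).congr_left fun w ↦ (hfourier w).symm
  have hP := Real.tsum_eq_tsum_fourier_of_rpow_decay hcont hs hdecay hfdecay 0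
  have hleft : ∑' n : ℤ, g (0 + n) =
      ∑' k : ℕ, ((k : ℂ) + 1) ^ (s - 1) * cexp (2 * π * I * τ * (k + 1)) := by
    have hinj : Function.Injective fun k : ℕ ↦ (k : ℤ) + 1 := fun a b h ↦ by simpa using h
    rw [← hinj.tsum_eq]
    · refine tsum_congr fun k ↦ ?_
      rw [hg_pos _ (by push_cast; positivity)]
      push_cast
      simp
    · intro n hn
      rw [Function.mem_support] at hn
      have hn0 : 0 < n := by
        by_contra! h
        exact hn (hg_nonpos _ (by simpa using (Int.cast_nonpos (R := ℝ)).mpr h))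
      exact ⟨(n - 1).toNat, by simp only; omega⟩
  have hright : ∑' n : ℤ, 𝓕 g n * fourier n ((0 : ℝ) : UnitAddCircle) =
      (2 * π : ℂ) ^ (-s) * cexp (π * I * s / 2) * Complex.Gamma s * ∑' n : ℤ, (τ + n) ^ (-s) := by
    rw [← (Equiv.neg ℤ).tsum_eq fun n : ℤ ↦ (τ + n) ^ (-s), ← tsum_mul_left]
    refine tsum_congr fun n ↦ ?_
    rw [hfourier]
    simp [sub_eq_add_neg]
  rw [hleft, hright] at hP
  have hπ : (2 * π : ℂ) ≠ 0 := by simp [Real.pi_ne_zero]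
  have hΓ := Complex.Gamma_ne_zero_of_re_pos hs0
  have hp : (2 * π : ℂ) ^ s ≠ 0 := by simp [Complex.cpow_eq_zero_iff, Real.pi_ne_zero]
  rw [hP, Complex.cpow_neg, Complex.exp_neg]
  field_simp [Complex.exp_ne_zero]

theorem im_add_sum_pos {r : ℕ} {z : ℂ} {ω : Fin r → ℂ} (hz : 0 < z.im)
    (hω : ∀ j, 0 < (ω j).im) (m : Fin r → ℕ) : 0 < (z + ∑ j, (m j : ℂ) * ω j).im := by
  have : 0 ≤ ∑ j, (m j : ℝ) * (ω j).im :=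
    Finset.sum_nonneg fun j _ ↦ mul_nonneg (Nat.cast_nonneg _) (hω j).le
  simp
  linarith

theorem barnesZeta_cons (r : ℕ) (s z w : ℂ) (ω : Fin r → ℂ) :
    barnesZeta (r + 1) s z (Fin.cons w ω) =
      ∑' p : ℕ × (Fin r → ℕ), (z + p.1 * w + ∑ j, (p.2 j : ℂ) * ω j) ^ (-s) := by
  rw [barnesZeta, ← (Fin.consEquiv fun _ ↦ ℕ).tsum_eq]
  refine tsum_congr fun p ↦ ?_
  simp [Fin.consEquiv, Fin.sum_univ_succ, add_assoc]

theorem xiSeries_eq_tsum_int {r : ℕ} {s z : ℂ} {ω : Fin r → ℂ} (hz : 0 < z.im)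
    (hω : ∀ j, 0 < (ω j).im) (hs : (r : ℝ) + 1 < s.re) :
    xiSeries r s z ω =
      ∑' m : Fin r → ℕ, ∑' n : ℤ, (z + ∑ j, (m j : ℂ) * ω j + n) ^ (-s) := by
  have h1 := (summable_cpow_shifted_cone hz hω (u := fun n ↦ -(n + 1))
    (fun n ↦ by rw [abs_neg, abs_of_nonneg (by positivity)]; linarith) hs).prod_symm
  have h2 := (summable_cpow_shifted_cone hz hω (u := fun n ↦ n)
    (fun n ↦ (abs_of_nonneg (by positivity)).ge) hs).prod_symm
  have e1 : barnesZeta (r + 1) s (z + (-1)) (Fin.cons (-1) ω) = _ :=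
    (barnesZeta_cons r s _ _ ω).trans <| (Equiv.prodComm _ _).tsum_eq
      (fun p : ℕ × (Fin r → ℕ) ↦ (z + (-1) + p.1 * (-1) + ∑ j, (p.2 j : ℂ) * ω j) ^ (-s)) |>.symm
  have e2 : barnesZeta (r + 1) s z (Fin.cons 1 ω) = _ :=
    (barnesZeta_cons r s _ _ ω).trans <| (Equiv.prodComm _ _).tsum_eq
      (fun p : ℕ × (Fin r → ℕ) ↦ (z + p.1 * 1 + ∑ j, (p.2 j : ℂ) * ω j) ^ (-s)) |>.symm
  replace h1 : Summable fun p : (Fin r → ℕ) × ℕ ↦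
      (z + ∑ j, (p.1 j : ℂ) * ω j + ((-((p.2 : ℤ) + 1) : ℤ) : ℂ)) ^ (-s) := by
    refine h1.congr fun p ↦ ?_
    congr 1
    simp
    ring
  replace h2 : Summable fun p : (Fin r → ℕ) × ℕ ↦
      (z + ∑ j, (p.1 j : ℂ) * ω j + ((p.2 : ℤ) : ℂ)) ^ (-s) := by
    refine h2.congr fun p ↦ ?_
    congr 1
    simp
    ring
  replace e1 : barnesZeta (r + 1) s (z + (-1)) (Fin.cons (-1) ω) = ∑' p : (Fin r → ℕ) × ℕ,
      (z + ∑ j, (p.1 j : ℂ) * ω j + ((-((p.2 : ℤ) + 1) : ℤ) : ℂ)) ^ (-s) := by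
    refine e1.trans (tsum_congr fun p ↦ ?_)
    congr 1
    simp
    ring
  replace e2 : barnesZeta (r + 1) s z (Fin.cons 1 ω) = ∑' p : (Fin r → ℕ) × ℕ,
      (z + ∑ j, (p.1 j : ℂ) * ω j + ((p.2 : ℤ) : ℂ)) ^ (-s) := by
    refine e2.trans (tsum_congr fun p ↦ ?_)
    congr 1
    simp
    ring
  rw [xiSeries, e1, e2, h1.tsum_prod, h2.tsum_prod, add_comm, ← h2.prod.tsum_add h1.prod]
  refine tsum_congr fun m ↦ ?_
  exact (tsum_of_nat_of_neg_add_one (f := fun n : ℤ ↦ (z + ∑ j, (m j : ℂ) * ω j + n) ^ (-s))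
    (h2.prod_factor m) (h1.prod_factor m)).symm

/-- A majorant, uniform in the half-plane `s.re - 1 ≤ R`, for the terms of the Fourier expansion. -/
theorem exists_summable_bound {r : ℕ} {z : ℂ} {ω : Fin r → ℂ} (hz : 0 < z.im)
    (hω : ∀ j, 0 < (ω j).im) (R : ℕ) :
    ∃ b : ℕ × (Fin r → ℕ) → ℝ, Summable b ∧ ∀ (s : ℂ) (k : ℕ) (m : Fin r → ℕ), s.re - 1 ≤ R →
      ‖((k : ℂ) + 1) ^ (s - 1) * cexp (2 * π * I * (z + ∑ j, (m j : ℂ) * ω j) * (k + 1))‖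
        ≤ b (k, m) := by
  have hgeom {y : ℝ} (hy : 0 < y) : ‖rexp (-(2 * π * y))‖ < 1 := by
    rw [Real.norm_of_nonneg (Real.exp_pos _).le, Real.exp_lt_one_iff]
    have := mul_pos Real.two_pi_pos hy
    linarith
  have h1 := (summable_nat_add_iff 1).mpr
    (summable_pow_mul_geometric_of_norm_lt_one (R := ℝ) R (hgeom hz))
  have h2 := summable_fin_prod (f := fun j n ↦ rexp (-(2 * π * (ω j).im)) ^ n)
    (fun _ _ ↦ by positivity) fun j ↦ summable_geometric_of_norm_lt_one (hgeom (hω j))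
  refine ⟨_, h1.mul_of_nonneg h2 (fun _ ↦ by dsimp; positivity) (fun _ ↦ by dsimp; positivity), ?_⟩
  intro s k m hs
  have hk : ((k : ℂ) + 1) = ((k + 1 : ℝ) : ℂ) := by push_cast; rfl
  have hk1 : (1 : ℝ) ≤ k + 1 := by linarith [(Nat.cast_nonneg k : (0 : ℝ) ≤ k)]
  rw [norm_mul, hk, Complex.norm_cpow_eq_rpow_re_of_pos (by positivity), Complex.norm_exp]
  refine (mul_le_mul ?_ ?_ (Real.exp_pos _).le (by positivity)).trans_eq (mul_assoc _ _ _).symm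
  · calc ((k : ℝ) + 1) ^ (s - 1).re ≤ ((k : ℝ) + 1) ^ (R : ℝ) :=
          Real.rpow_le_rpow_of_exponent_le hk1 (by simpa using hs)
      _ = _ := by rw [Real.rpow_natCast]; push_cast; rfl
  · dsimp only
    simp_rw [← Real.exp_nat_mul]
    rw [← Real.exp_sum, ← Real.exp_add, Real.exp_le_exp]
    have hS : 0 ≤ ∑ j, (m j : ℝ) * (ω j).im :=
      Finset.sum_nonneg fun j _ ↦ mul_nonneg (Nat.cast_nonneg _) (hω j).le
    have e1 : (2 * π * I * (z + ∑ j, (m j : ℂ) * ω j) * ((k + 1 : ℝ) : ℂ)).re =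
        -(2 * π) * ((z.im + ∑ j, (m j : ℝ) * (ω j).im) * (k + 1)) := by
      rw [Complex.re_mul_ofReal]
      simp
      ring
    have e2 : ∑ j, (m j : ℝ) * -(2 * π * (ω j).im) = -(2 * π) * ∑ j, (m j : ℝ) * (ω j).im := by
      rw [Finset.mul_sum]
      exact Finset.sum_congr rfl fun j _ ↦ by ring
    rw [e1, e2]
    have := mul_nonneg (mul_nonneg Real.two_pi_pos.le hS) (Nat.cast_nonneg (α := ℝ) k)
    push_cast
    linarith

/-- The Dirichlet-type series `∑ k^{s-1} e^{2πikz} / ∏ (1 - q_j^k)` of the Fourier expansion. -/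
noncomputable def fourierSeriesXi (r : ℕ) (z : ℂ) (ω : Fin r → ℂ) (s : ℂ) : ℂ :=
  ∑' k : ℕ, ∑' m : Fin r → ℕ,
    ((k : ℂ) + 1) ^ (s - 1) * cexp (2 * π * I * (z + ∑ j, (m j : ℂ) * ω j) * (k + 1))

theorem summable_fourierSeriesXi {r : ℕ} {z : ℂ} {ω : Fin r → ℂ} (hz : 0 < z.im)
    (hω : ∀ j, 0 < (ω j).im) (s : ℂ) : Summable fun p : ℕ × (Fin r → ℕ) ↦
      ((p.1 : ℂ) + 1) ^ (s - 1) *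
        cexp (2 * π * I * (z + ∑ j, (p.2 j : ℂ) * ω j) * (p.1 + 1)) := by
  obtain ⟨R, hR⟩ := exists_nat_ge (s.re - 1)
  obtain ⟨b, hb, hle⟩ := exists_summable_bound hz hω R
  exact Summable.of_norm_bounded hb fun p ↦ hle s p.1 p.2 hR

theorem differentiable_fourierSeriesXi {r : ℕ} {z : ℂ} {ω : Fin r → ℂ} (hz : 0 < z.im)
    (hω : ∀ j, 0 < (ω j).im) : Differentiable ℂ (fourierSeriesXi r z ω) := by
  intro s₀
  obtain ⟨R, hR⟩ := exists_nat_gt (s₀.re - 1)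
  obtain ⟨b, hb, hle⟩ := exists_summable_bound hz hω R
  have hU : IsOpen {s : ℂ | s.re - 1 < R} :=
    isOpen_lt (Complex.continuous_re.sub continuous_const) continuous_const
  have hd : DifferentiableOn ℂ (fun s ↦ ∑' p : ℕ × (Fin r → ℕ), ((p.1 : ℂ) + 1) ^ (s - 1) *
      cexp (2 * π * I * (z + ∑ j, (p.2 j : ℂ) * ω j) * (p.1 + 1))) {s : ℂ | s.re - 1 < R} := by
    refine differentiableOn_tsum_of_summable_norm hb (fun p ↦ ?_) hU
      fun p s (hs : s.re - 1 < R) ↦ hle s p.1 p.2 hs.le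
    refine (Differentiable.mul_const (Differentiable.const_cpow (by fun_prop) ?_) _).differentiableOn
    exact Or.inl (Nat.cast_add_one_ne_zero _)
  refine (hd.differentiableAt (hU.mem_nhds hR)).congr_of_eventuallyEq (.of_forall fun s ↦ ?_)
  exact (summable_fourierSeriesXi hz hω s).tsum_prod.symm

theorem xiSeries_eq_fourierSeriesXi {r : ℕ} {s z : ℂ} {ω : Fin r → ℂ} (hz : 0 < z.im)
    (hω : ∀ j, 0 < (ω j).im) (hs : (r : ℝ) + 1 < s.re) :
    xiSeries r s z ω = (2 * π : ℂ) ^ s * cexp (-(π * I * s / 2)) * (Complex.Gamma s)⁻¹ *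
      fourierSeriesXi r z ω s := by
  rw [xiSeries_eq_tsum_int hz hω hs]
  simp_rw [fun m ↦ tsum_int_add_cpow_neg (im_add_sum_pos hz hω m)
    (by linarith [(Nat.cast_nonneg r : (0 : ℝ) ≤ r)] : 1 < s.re)]
  rw [tsum_mul_left, div_eq_mul_inv, fourierSeriesXi]
  congr 1
  exact (summable_fourierSeriesXi hz hω s).tsum_comm

theorem cexp_neg_fourierSeriesXi_zero {r : ℕ} {z : ℂ} {ω : Fin r → ℂ} (hz : 0 < z.im)
    (hω : ∀ j, 0 < (ω j).im) : cexp (-fourierSeriesXi r z ω 0) =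
      ∏' m : Fin r → ℕ, (1 - cexp (2 * π * I * (z + ∑ j, (m j : ℂ) * ω j))) := by
  have hlt (m : Fin r → ℕ) : ‖cexp (2 * π * I * (z + ∑ j, (m j : ℂ) * ω j))‖ < 1 := by
    have h1 : (2 * π * I * (z + ∑ j, (m j : ℂ) * ω j)).re =
        -(2 * π * (z + ∑ j, (m j : ℂ) * ω j).im) := by simp
    rw [Complex.norm_exp, Real.exp_lt_one_iff, h1]
    have := mul_pos Real.two_pi_pos (im_add_sum_pos hz hω m)
    linarith
  have hsum := summable_fourierSeriesXi hz hω 0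
  have hterm (m : Fin r → ℕ) :
      ∑' k : ℕ, ((k : ℂ) + 1) ^ ((0 : ℂ) - 1) *
        cexp (2 * π * I * (z + ∑ j, (m j : ℂ) * ω j) * (k + 1)) =
      -Complex.log (1 - cexp (2 * π * I * (z + ∑ j, (m j : ℂ) * ω j))) := by
    rw [← (hasSum_taylorSeries_neg_log' (hlt m)).tsum_eq]
    refine tsum_congr fun k ↦ ?_
    rw [zero_sub, Complex.cpow_neg_one, ← Complex.exp_nat_mul, div_eq_inv_mul]
    push_cast
    rw [mul_comm ((k : ℂ) + 1)]
  have hlog : Summable fun m : Fin r → ℕ ↦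
      Complex.log (1 - cexp (2 * π * I * (z + ∑ j, (m j : ℂ) * ω j))) := by
    refine hsum.prod_symm.prod.neg.congr fun m ↦ ?_
    exact neg_eq_iff_eq_neg.mpr (hterm m)
  have hne (m : Fin r → ℕ) : 1 - cexp (2 * π * I * (z + ∑ j, (m j : ℂ) * ω j)) ≠ 0 := by
    intro h
    have := hlt m
    rw [← sub_eq_zero.mp h] at this
    simp at this
  rw [← Complex.cexp_tsum_eq_tprod hne hlog, fourierSeriesXi, hsum.prod_symm.tsum_comm]
  simp_rw [hterm, tsum_neg, neg_neg]

theorem hasDerivAt_Gamma_inv_zero : HasDerivAt (fun s ↦ (Complex.Gamma s)⁻¹) 1 0 := by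
  have h : (fun s ↦ (Complex.Gamma s)⁻¹) = fun s ↦ s * (Complex.Gamma (s + 1))⁻¹ :=
    funext Complex.one_div_Gamma_eq_self_mul_one_div_Gamma_add_one
  rw [h]
  have hd : HasDerivAt (fun s : ℂ ↦ (Complex.Gamma (s + 1))⁻¹) _ 0 :=
    ((Complex.differentiable_one_div_Gamma.comp (differentiable_id.add_const 1)) 0).hasDerivAt
  exact ((hasDerivAt_id' (0 : ℂ)).fun_mul hd).congr_deriv (by simp)

/-- `exp(−∂ξ_{r+1}/∂s(0, z | e^{πi}; ω))` equals the `r`-fold `q`-shifted factorial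
`∏_{m ∈ ℕ^r} (1 − e^{2πi(z + Σ m_j ω_j)})`, where `F` is the entire continuation of
the bilateral zeta series. -/
theorem xi_deriv_zero_qfactorial (r : ℕ) (z : ℂ) (ω : Fin r → ℂ)
    (hz : 0 < z.im) (hω : ∀ j, 0 < (ω j).im)
    (F : ℂ → ℂ) (hF : Differentiable ℂ F)
    (hagree : ∀ s : ℂ, ((r : ℝ) + 1) < s.re → F s = xiSeries r s z ω) :
    Complex.exp (-(deriv F 0))
      = ∏' m : Fin r → ℕ,
          (1 - Complex.exp (2 * π * I * (z + ∑ j, (m j : ℂ) * ω j))) := by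
  have hπ : (2 * π : ℂ) ≠ 0 := by simp [Real.pi_ne_zero]
  set A : ℂ → ℂ := fun s ↦ (2 * π : ℂ) ^ s * cexp (-(π * I * s / 2)) * fourierSeriesXi r z ω s
    with hA
  have hAd : Differentiable ℂ A :=
    ((differentiable_id.const_cpow (Or.inl hπ)).mul (by fun_prop)).mul
      (differentiable_fourierSeriesXi hz hω)
  have hFA : F = fun s ↦ (Complex.Gamma s)⁻¹ * A s := by
    have hGd : Differentiable ℂ fun s ↦ (Complex.Gamma s)⁻¹ * A s :=
      Complex.differentiable_one_div_Gamma.mul hAd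
    refine AnalyticOnNhd.eq_of_eventuallyEq (𝕜 := ℂ) (z₀ := (r : ℂ) + 2)
      (Complex.analyticOnNhd_univ_iff_differentiable.mpr hF)
      (Complex.analyticOnNhd_univ_iff_differentiable.mpr hGd) ?_
    have hU : IsOpen {s : ℂ | (r : ℝ) + 1 < s.re} :=
      isOpen_lt continuous_const Complex.continuous_re
    filter_upwards [hU.mem_nhds (by simp : (r : ℂ) + 2 ∈ _)] with s hs
    rw [hagree s hs, xiSeries_eq_fourierSeriesXi hz hω hs, hA]
    ring
  have hderiv : deriv F 0 = fourierSeriesXi r z ω 0 := by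
    rw [hFA, (hasDerivAt_Gamma_inv_zero.fun_mul (hAd 0).hasDerivAt).deriv]
    simp [hA]
  rw [hderiv, cexp_neg_fourierSeriesXi_zero hz hω]
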